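/- arXiv:2003.09215 — 2 statements merged into one kernel-verified Lean document; each statement's English description precedes it below -/
import Mathlib

section
/- Let n ≥ 1 and m ≥ 1. Then, in the polynomial ring ℤ[x_1,…,x_n,y_1,…,y_m], the dual Cauchy identity holds: ∏_{i=1}^n ∏_{j=1}^m (1 + x_i y_j) = Σ_λ S_λ(x_1,…,x_n) · S_{λ'}(y_1,…,y_m), where λ ranges over all partitions whose Young diagram fits in an n×m box (at most n rows and at most m columns), and λ' denotes the conjugate (transpose) partition of λ. -/
/-- `T` is a semistandard Young tableau of shape `lam` (a partition with at most `n` parts,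
rows and entries 0-indexed): rows weakly increase and columns strictly increase. -/
def IsSSYT {n : ℕ} (lam : Fin n → ℕ) (T : ∀ i : Fin n, Fin (lam i) → Fin n) : Prop :=
  (∀ (i : Fin n) (j j' : Fin (lam i)), j ≤ j' → T i j ≤ T i j') ∧
  (∀ (i i' : Fin n) (j : Fin (lam i)) (j' : Fin (lam i')),
    i < i' → (j : ℕ) = (j' : ℕ) → T i j < T i' j')

open MvPolynomial in
/-- The Schur polynomial `S_λ(x_1,…,x_n) = Σ_T x^T`, the sum over all semistandard Young
tableaux of shape `λ` with entries in `{1,…,n}`. -/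
noncomputable def schurPoly (n : ℕ) (lam : Fin n → ℕ) : MvPolynomial (Fin n) ℤ :=
  ∑ᶠ T : {T : ∀ i : Fin n, Fin (lam i) → Fin n // IsSSYT lam T},
    ∏ i : Fin n, ∏ j : Fin (lam i), X (T.1 i j)

/-- The conjugate (transpose) partition of `lam` (0-indexed rows): its `j`-th row length
is the number of rows of `lam` of length at least `j + 1`. -/
def conjPartition {n : ℕ} (m : ℕ) (lam : Fin n → ℕ) : Fin m → ℕ :=
  fun j => (Finset.univ.filter fun i : Fin n => (j : ℕ) < lam i).card

section DualCauchyIdentity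

open Finset

section Local

variable {R : Type*} [CommRing R]

theorem sum_add_box_mul_sum_add_box (x z : R) {a b c d : ℕ} (hca : c ≤ a) (hdb : d ≤ b) :
    (∑ l ∈ Icc a (a + 1) with b ≤ l, x ^ (l - a) * z ^ (l - b)) *
      (∑ l ∈ Icc c (c + 1) with d ≤ l ∧ l ≤ b, x ^ (l - c) * z ^ (l - d)) =
    (∑ k ∈ Icc c a with k ≤ b ∧ b ≤ k + 1, x ^ (b - k) * z ^ (a - k)) *
      (∑ l ∈ Icc c (c + 1) with d ≤ l, x ^ (l - c) * z ^ (l - d)) := by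
  have pair (k : ℕ) : Icc k (k + 1) = {k, k + 1} := by ext; simp; omega
  have hb : (Icc c a).filter (fun k => k ≤ b ∧ b ≤ k + 1) =
      (Icc (b - 1) b).filter (fun k => c ≤ k ∧ k ≤ a) := by ext; simp; omega
  rw [hb]
  rcases lt_trichotomy c b with h | rfl | h
  · have hc : (Icc c (c + 1)).filter (fun l => d ≤ l ∧ l ≤ b) =
        (Icc c (c + 1)).filter (fun l => d ≤ l) := by ext; simp; omega
    rw [hc]
    congr 1
    obtain ⟨b, rfl⟩ : ∃ b', b = b' + 1 := ⟨b - 1, by omega⟩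
    rw [Nat.add_sub_cancel, pair, pair, sum_filter, sum_filter, sum_pair (by simp),
      sum_pair (by simp)]
    rcases lt_trichotomy a b with h' | rfl | h'
    · rw [if_neg (by omega), if_neg (by omega), if_neg (by omega), if_neg (by omega)]
    · rw [if_neg (by omega), if_pos (by omega), if_pos (by omega), if_neg (by omega)]
      simp
    · obtain ⟨e, rfl⟩ := Nat.exists_eq_add_of_lt h'
      rw [if_pos (by omega), if_pos (by omega), if_pos (by omega), if_pos (by omega),
        show b + e + 1 - (b + 1) = e by omega, show b + e + 1 - b = e + 1 by omega,
        show b + e + 1 + 1 - (b + 1) = e + 1 by omega]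
      simp
      ring
  · obtain ⟨e, rfl⟩ := Nat.exists_eq_add_of_le hca
    have h1 : (Icc c (c + 1)).filter (fun l => d ≤ l ∧ l ≤ c) = {c} := by ext; simp; omega
    have h2 : (Icc (c - 1) c).filter (fun k => c ≤ k ∧ k ≤ c + e) = {c} := by ext; simp; omega
    rw [h1, h2, pair, pair, sum_filter, sum_filter, sum_pair (by simp), sum_pair (by simp),
      if_pos (by omega), if_pos (by omega), if_pos (by omega), if_pos (by omega),
      show c + e + 1 - c = e + 1 by omega, show c + 1 - d = (c - d) + 1 by omega]
    simp
    ring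
  · have h1 : (Icc c (c + 1)).filter (fun l => d ≤ l ∧ l ≤ b) = ∅ := by ext; simp; omega
    have h2 : (Icc (b - 1) b).filter (fun k => c ≤ k ∧ k ≤ a) = ∅ := by ext; simp; omega
    rw [h1, h2]
    simp

theorem prod_sum_add_box (x z : R) : ∀ {m : ℕ} {ν ρ : Fin (m + 1) → ℕ},
    Antitone ν → Antitone ρ →
    (∑ l ∈ Icc (ν 0) (ν 0 + 1) with ρ 0 ≤ l, x ^ (l - ν 0) * z ^ (l - ρ 0)) *
      ∏ i : Fin m, (∑ l ∈ Icc (ν i.succ) (ν i.succ + 1) with ρ i.succ ≤ l ∧ l ≤ ρ i.castSucc,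
        x ^ (l - ν i.succ) * z ^ (l - ρ i.succ)) =
    (∏ i : Fin m, ∑ k ∈ Icc (ν i.succ) (ν i.castSucc) with k ≤ ρ i.castSucc ∧ ρ i.castSucc ≤ k + 1,
        x ^ (ρ i.castSucc - k) * z ^ (ν i.castSucc - k)) *
      ∑ l ∈ Icc (ν (Fin.last m)) (ν (Fin.last m) + 1) with ρ (Fin.last m) ≤ l,
        x ^ (l - ν (Fin.last m)) * z ^ (l - ρ (Fin.last m))
  | 0, ν, ρ, _, _ => by simp
  | m + 1, ν, ρ, hν, hρ => by
    have ih := prod_sum_add_box x z (hν.comp_monotone Fin.strictMono_castSucc.monotone)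
      (hρ.comp_monotone Fin.strictMono_castSucc.monotone)
    rw [Fin.prod_univ_castSucc, Fin.prod_univ_castSucc, ← mul_assoc]
    refine (congrArg (· * _) ih).trans ?_
    rw [mul_assoc, mul_assoc]
    exact congrArg _ (sum_add_box_mul_sum_add_box x z (hν (Fin.le_last _)) (hρ (Fin.le_last _)))

end Local

section Strips

/-- The partitions `μ` interlacing `lam`, that is, such that `lam / μ` is a horizontal strip. -/
def interlacing {n : ℕ} (lam : Fin (n + 1) → ℕ) : Finset (Fin n → ℕ) :=
  Fintype.piFinset fun i => Icc (lam i.succ) (lam i.castSucc)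

open Classical in
/-- The partitions obtained from `ν` by adding at most one box to each row. -/
noncomputable def verticalStrips {m : ℕ} (ν : Fin m → ℕ) : Finset (Fin m → ℕ) :=
  {lam ∈ Fintype.piFinset fun i => Icc (ν i) (ν i + 1) | Antitone lam}

open Classical in
/-- The partitions whose Young diagram fits in an `n × m` box. -/
noncomputable def boxPartitions (n m : ℕ) : Finset (Fin n → ℕ) :=
  {lam ∈ Fintype.piFinset fun _ => range (m + 1) | Antitone lam}

theorem mem_interlacing {n : ℕ} {lam : Fin (n + 1) → ℕ} {μ : Fin n → ℕ} :
    μ ∈ interlacing lam ↔ ∀ i, lam i.succ ≤ μ i ∧ μ i ≤ lam i.castSucc := by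
  simp [interlacing]

theorem mem_verticalStrips {m : ℕ} {ν lam : Fin m → ℕ} :
    lam ∈ verticalStrips ν ↔ (∀ i, ν i ≤ lam i ∧ lam i ≤ ν i + 1) ∧ Antitone lam := by
  simp [verticalStrips]

theorem mem_boxPartitions {n m : ℕ} {lam : Fin n → ℕ} :
    lam ∈ boxPartitions n m ↔ Antitone lam ∧ ∀ i, lam i ≤ m := by
  simp [boxPartitions, and_comm]

theorem antitone_of_mem_interlacing {n : ℕ} {lam : Fin (n + 1) → ℕ} {μ : Fin n → ℕ}
    (h : μ ∈ interlacing lam) : Antitone μ := by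
  rw [mem_interlacing] at h
  cases n with
  | zero => exact fun i => i.elim0
  | succ n =>
    refine Fin.antitone_iff_succ_le.2 fun i => ?_
    exact (h i.succ).2.trans (by rw [← Fin.succ_castSucc]; exact (h i.castSucc).1)

theorem antitone_of_interlacing_mem {n : ℕ} {lam : Fin (n + 1) → ℕ} {μ : Fin n → ℕ}
    (h : μ ∈ interlacing lam) : Antitone lam := by
  rw [mem_interlacing] at h
  exact Fin.antitone_iff_succ_le.2 fun i => (h i).1.trans (h i).2

variable {R : Type*} [CommRing R]

/-- The commutation relation between adding vertical strips and removing horizontal strips. -/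
theorem sum_verticalStrips_eq_sum_interlacing (x z : R) {m : ℕ} {ν : Fin (m + 1) → ℕ}
    {ρ : Fin m → ℕ} (hν : Antitone ν) (hρ : Antitone ρ) :
    ∑ lam ∈ verticalStrips ν with ρ ∈ interlacing lam, (∏ i, x ^ (lam i - ν i)) *
      (z ^ lam (Fin.last m) * ∏ i : Fin m, z ^ (lam i.castSucc - ρ i)) =
    (1 + x * z) * ∑ κ ∈ interlacing ν with ρ ∈ verticalStrips κ, (∏ i, x ^ (ρ i - κ i)) *
      (z ^ ν (Fin.last m) * ∏ i : Fin m, z ^ (ν i.castSucc - κ i)) := by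
  set σ : Fin (m + 1) → ℕ := Fin.snoc (α := fun _ => ℕ) ρ 0 with hσ
  have σc (i : Fin m) : σ i.castSucc = ρ i := by simp [hσ]
  have σl : σ (Fin.last m) = 0 := by simp [hσ]
  have hσa : Antitone σ := by
    intro i j hij
    induction j using Fin.lastCases with
    | last => simp [σl]
    | cast j =>
      induction i using Fin.lastCases with
      | last => exact absurd hij (by simp)
      | cast i => rw [σc, σc]; exact hρ (by simpa using hij)
  have key := prod_sum_add_box x z hν hσa
  have hlast : ∑ l ∈ Icc (ν (Fin.last m)) (ν (Fin.last m) + 1) with σ (Fin.last m) ≤ l,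
      x ^ (l - ν (Fin.last m)) * z ^ (l - σ (Fin.last m)) =
      (1 + x * z) * z ^ ν (Fin.last m) := by
    have pair (k : ℕ) : Icc k (k + 1) = {k, k + 1} := by ext; simp; omega
    rw [pair, sum_filter, sum_pair (by simp), σl]
    simp
    ring
  let S : Fin (m + 1) → Finset ℕ := Fin.cons
    (α := fun _ => Finset ℕ) {l ∈ Icc (ν 0) (ν 0 + 1) | σ 0 ≤ l}
    (fun i => {l ∈ Icc (ν i.succ) (ν i.succ + 1) | σ i.succ ≤ l ∧ l ≤ σ i.castSucc})
  have hL : {lam ∈ verticalStrips ν | ρ ∈ interlacing lam} = Fintype.piFinset S := by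
    ext lam
    have h1 : (∀ i : Fin m, ρ i ≤ lam i.castSucc) ↔ ∀ i, σ i ≤ lam i := by
      rw [Fin.forall_fin_succ']
      simp [σc, σl]
    rw [mem_filter, mem_verticalStrips, Fintype.mem_piFinset,
      Fin.forall_fin_succ (P := fun i => lam i ∈ S i)]
    have h2 : (∀ i, ν i ≤ lam i ∧ lam i ≤ ν i + 1) ∧ ρ ∈ interlacing lam ↔
        lam 0 ∈ S 0 ∧ ∀ i : Fin m, lam i.succ ∈ S i.succ := by
      simp only [mem_interlacing, forall_and, h1]
      simp only [Fin.forall_fin_succ (n := m), S, Fin.cons_zero, Fin.cons_succ, mem_filter, mem_Icc,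
        forall_and, σc]
      tauto
    rw [← h2]
    exact ⟨fun h => ⟨h.1.1, h.2⟩, fun h => ⟨⟨h.1, antitone_of_interlacing_mem h.2⟩, h.2⟩⟩
  have hK : {κ ∈ interlacing ν | ρ ∈ verticalStrips κ} = Fintype.piFinset fun i : Fin m =>
      {k ∈ Icc (ν i.succ) (ν i.castSucc) | k ≤ σ i.castSucc ∧ σ i.castSucc ≤ k + 1} := by
    ext κ
    simp only [mem_filter, mem_interlacing, mem_verticalStrips, Fintype.mem_piFinset, mem_Icc, σc,
      hρ, and_true, forall_and]
  have hw (lam : Fin (m + 1) → ℕ) : (∏ i, x ^ (lam i - ν i)) *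
      (z ^ lam (Fin.last m) * ∏ i : Fin m, z ^ (lam i.castSucc - ρ i)) =
      ∏ i, x ^ (lam i - ν i) * z ^ (lam i - σ i) := by
    rw [prod_mul_distrib, Fin.prod_univ_castSucc (fun i => z ^ (lam i - σ i))]
    simp only [σc, σl, Nat.sub_zero, mul_comm]
  have hw' (κ : Fin m → ℕ) : (∏ i, x ^ (ρ i - κ i)) *
      (z ^ ν (Fin.last m) * ∏ i : Fin m, z ^ (ν i.castSucc - κ i)) =
      z ^ ν (Fin.last m) * ∏ i : Fin m, x ^ (σ i.castSucc - κ i) * z ^ (ν i.castSucc - κ i) := by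
    rw [prod_mul_distrib]
    simp only [σc]
    ring
  simp only [hw, hw']
  rw [hL, hK, ← mul_sum]
  rw [← prod_univ_sum S fun i l => x ^ (l - ν i) * z ^ (l - σ i),
    ← prod_univ_sum _ fun (i : Fin m) k => x ^ (σ i.castSucc - k) * z ^ (ν i.castSucc - k),
    Fin.prod_univ_succ]
  simp only [S, Fin.cons_zero, Fin.cons_succ]
  rw [key, hlast]
  ring

end Strips

section Schur

variable {R : Type*} [CommRing R]

open Classical in
/-- The value of the Schur polynomial of shape `lam` at a point `x`. -/
noncomputable def schurValue {n : ℕ} (lam : Fin n → ℕ) (x : Fin n → R) : R :=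
  ∑ T : {T : ∀ i : Fin n, Fin (lam i) → Fin n // IsSSYT lam T},
    ∏ i : Fin n, ∏ j : Fin (lam i), x (T.1 i j)

theorem rename_schurPoly {σ : Type*} {n : ℕ} (lam : Fin n → ℕ) (f : Fin n → σ) :
    MvPolynomial.rename f (schurPoly n lam) =
      schurValue lam fun i => (MvPolynomial.X (f i) : MvPolynomial σ ℤ) := by
  classical
  simp [schurPoly, schurValue, finsum_eq_sum_of_fintype, map_sum, map_prod]

theorem schurValue_eq_one {n : ℕ} {lam : Fin n → ℕ} (h : ∀ i, lam i = 0) (x : Fin n → R) :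
    schurValue lam x = 1 := by
  classical
  have (i : Fin n) : IsEmpty (Fin (lam i)) := by rw [h i]; infer_instance
  have : Unique {T : ∀ i : Fin n, Fin (lam i) → Fin n // IsSSYT lam T} :=
    { default := ⟨fun i j => isEmptyElim j, fun i j => isEmptyElim j, fun i i' j => isEmptyElim j⟩
      uniq := fun T => Subtype.ext (funext fun i => funext fun j => isEmptyElim j) }
  simp [schurValue]

namespace IsSSYT

theorem val_le_apply {n : ℕ} {lam : Fin n → ℕ} (hlam : Antitone lam)
    {T : ∀ i : Fin n, Fin (lam i) → Fin n} (hT : IsSSYT lam T) :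
    ∀ (k : ℕ) (hk : k < n) (j : Fin (lam ⟨k, hk⟩)), k ≤ T ⟨k, hk⟩ j
  | 0, _, _ => Nat.zero_le _
  | k + 1, hk, j => by
    have hle : lam ⟨k + 1, hk⟩ ≤ lam ⟨k, by omega⟩ := hlam (by simp)
    have h1 := val_le_apply hlam hT k (by omega) ⟨j, j.2.trans_le hle⟩
    have h2 := hT.2 ⟨k, by omega⟩ ⟨k + 1, hk⟩ ⟨j, j.2.trans_le hle⟩ j (by simp) rfl
    rw [Fin.lt_def] at h2
    omega

end IsSSYT

/-- Extend a tableau of shape `μ` to one of shape `lam` by filling the remaining boxes with the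
largest letter. -/
def extendTableau {n : ℕ} (lam : Fin (n + 1) → ℕ) (μ : Fin n → ℕ)
    (T : ∀ i : Fin n, Fin (μ i) → Fin n) (i : Fin (n + 1)) (j : Fin (lam i)) : Fin (n + 1) :=
  if h : ∃ hi : (i : ℕ) < n, (j : ℕ) < μ ⟨i, hi⟩ then (T ⟨i, h.1⟩ ⟨j, h.2⟩).castSucc
  else Fin.last n

theorem isSSYT_extendTableau {n : ℕ} {lam : Fin (n + 1) → ℕ} {μ : Fin n → ℕ}
    (hμ : μ ∈ interlacing lam) {T : ∀ i : Fin n, Fin (μ i) → Fin n} (hT : IsSSYT μ T) :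
    IsSSYT lam (extendTableau lam μ T) := by
  have ha := antitone_of_mem_interlacing hμ
  have hl := antitone_of_interlacing_mem hμ
  rw [mem_interlacing] at hμ
  refine ⟨fun i j j' hjj => ?_, fun i i' j j' hii hjj => ?_⟩
  · unfold extendTableau
    split_ifs with h1 h2 h2
    · exact Fin.castSucc_le_castSucc_iff.2 (hT.1 _ _ _ hjj)
    · exact Fin.le_last _
    · exact absurd ⟨h2.1, lt_of_le_of_lt hjj h2.2⟩ h1
    · exact le_rfl
  · have hi : (i : ℕ) < n := by rw [Fin.lt_def] at hii; omega
    have hj : (j : ℕ) < μ ⟨i, hi⟩ := by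
      have h1 := (hμ ⟨i, hi⟩).1
      have h2 : lam i' ≤ lam (Fin.succ ⟨i, hi⟩) := hl (by rw [Fin.le_def]; exact hii)
      have := j'.2
      omega
    unfold extendTableau
    rw [dif_pos ⟨hi, hj⟩]
    split_ifs with h2
    · exact Fin.castSucc_lt_castSucc_iff.2 (hT.2 _ _ _ _ hii hjj)
    · exact Fin.castSucc_lt_last _

theorem extendTableau_injective {n : ℕ} {lam : Fin (n + 1) → ℕ} {μ μ' : Fin n → ℕ}
    (hμ : μ ∈ interlacing lam) (hμ' : μ' ∈ interlacing lam)
    {T : ∀ i : Fin n, Fin (μ i) → Fin n} {T' : ∀ i : Fin n, Fin (μ' i) → Fin n}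
    (h : extendTableau lam μ T = extendTableau lam μ' T') : μ = μ' ∧ T ≍ T' := by
  rw [mem_interlacing] at hμ hμ'
  have aux (i : Fin n) (j : Fin (lam i.castSucc)) : (j : ℕ) < μ i ↔ (j : ℕ) < μ' i := by
    have := congrFun (congrFun h i.castSucc) j
    unfold extendTableau at this
    have hne (a : Fin n) : a.castSucc ≠ Fin.last n := (Fin.castSucc_lt_last a).ne
    by_cases h1 : (j : ℕ) < μ i <;> by_cases h2 : (j : ℕ) < μ' i <;> simp [h1, h2] at this ⊢
    exact hne _ this.symm
  obtain rfl : μ = μ' := by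
    funext i
    rcases lt_trichotomy (μ i) (μ' i) with hlt | heq | hlt
    · exact absurd ((aux i ⟨μ i, hlt.trans_le (hμ' i).2⟩).2 hlt) (lt_irrefl _)
    · exact heq
    · exact absurd ((aux i ⟨μ' i, hlt.trans_le (hμ i).2⟩).1 hlt) (lt_irrefl _)
  refine ⟨rfl, heq_of_eq ?_⟩
  funext i j
  have := congrFun (congrFun h i.castSucc) ⟨j, j.2.trans_le (hμ i).2⟩
  simpa [extendTableau] using this

theorem exists_lt_iff_ne_last {n k : ℕ} {f : Fin k → Fin (n + 1)} (hf : Monotone f) :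
    ∃ c ≤ k, ∀ j : Fin k, (j : ℕ) < c ↔ f j ≠ Fin.last n := by
  induction k with
  | zero => exact ⟨0, le_rfl, fun j => j.elim0⟩
  | succ k ih =>
    by_cases hl : f (Fin.last k) = Fin.last n
    · obtain ⟨c, hc, h⟩ := ih (hf.comp Fin.strictMono_castSucc.monotone)
      refine ⟨c, by omega, fun j => ?_⟩
      induction j using Fin.lastCases with
      | last => simpa [hl] using hc
      | cast j => exact h j
    · refine ⟨k + 1, le_rfl, fun j => ⟨fun _ h => hl ?_, fun _ => j.2⟩⟩
      exact le_antisymm (Fin.le_last _) (h ▸ hf (Fin.le_last j))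

theorem exists_extendTableau_eq {n : ℕ} {lam : Fin (n + 1) → ℕ} (hlam : Antitone lam)
    {T : ∀ i : Fin (n + 1), Fin (lam i) → Fin (n + 1)} (hT : IsSSYT lam T) :
    ∃ μ ∈ interlacing lam, ∃ T' : ∀ i : Fin n, Fin (μ i) → Fin n,
      IsSSYT μ T' ∧ extendTableau lam μ T' = T := by
  choose μ hle hμ using fun i : Fin n =>
    exists_lt_iff_ne_last (f := T i.castSucc) fun j j' h => hT.1 _ j j' h
  have hint : μ ∈ interlacing lam := by
    refine mem_interlacing.2 fun i => ⟨?_, hle i⟩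
    by_contra! hlt
    have hlt' : μ i < lam i.castSucc := hlt.trans_le (hlam (Fin.castSucc_lt_succ).le)
    have h1 := hT.2 i.castSucc i.succ ⟨μ i, hlt'⟩ ⟨μ i, hlt⟩ Fin.castSucc_lt_succ rfl
    exact (lt_irrefl _) ((hμ i ⟨μ i, hlt'⟩).2 (h1.trans_le (Fin.le_last _)).ne)
  refine ⟨μ, hint, fun i j => (T i.castSucc ⟨j, j.2.trans_le (hle i)⟩).castPred
    ((hμ i ⟨j, j.2.trans_le (hle i)⟩).1 j.2), ⟨fun i j j' h => ?_, fun i i' j j' hi hj => ?_⟩, ?_⟩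
  · exact Fin.castPred_le_castPred_iff.2 (hT.1 _ _ _ h)
  · exact Fin.castPred_lt_castPred_iff.2 (hT.2 _ _ _ _ (Fin.castSucc_lt_castSucc_iff.2 hi) hj)
  · funext i j
    unfold extendTableau
    induction i using Fin.lastCases with
    | last =>
      rw [dif_neg (by simp)]
      refine (le_antisymm (Fin.le_last _) ?_).symm
      exact hT.val_le_apply hlam n (Nat.lt_succ_self n) j
    | cast i =>
      split_ifs with h
      · simp
      · by_contra hne
        exact h ⟨i.2, (hμ i j).2 (Ne.symm hne)⟩

theorem prod_dite_lt {M : Type*} [CommMonoid M] {k l : ℕ} (h : k ≤ l) (g : Fin k → M) (c : M) :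
    ∏ j : Fin l, (if hj : (j : ℕ) < k then g ⟨j, hj⟩ else c) = (∏ j, g j) * c ^ (l - k) := by
  obtain ⟨d, rfl⟩ := Nat.exists_eq_add_of_le h
  rw [Fin.prod_univ_add]
  simp

theorem prod_extendTableau {n : ℕ} {lam : Fin (n + 1) → ℕ} {μ : Fin n → ℕ}
    (hμ : μ ∈ interlacing lam) (T : ∀ i : Fin n, Fin (μ i) → Fin n) (x : Fin (n + 1) → R) :
    ∏ i, ∏ j, x (extendTableau lam μ T i j) =
      (∏ i, ∏ j, x (T i j).castSucc) * (x (Fin.last n) ^ lam (Fin.last n) *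
        ∏ i : Fin n, x (Fin.last n) ^ (lam i.castSucc - μ i)) := by
  rw [Fin.prod_univ_castSucc, mul_comm (x _ ^ _), ← mul_assoc, ← prod_mul_distrib]
  congr 1
  · refine prod_congr rfl fun i _ => ?_
    rw [← prod_dite_lt (mem_interlacing.1 hμ i).2 (fun j => x (T i j).castSucc)]
    refine prod_congr rfl fun j _ => ?_
    unfold extendTableau
    by_cases h : (j : ℕ) < μ i <;> simp [h]
  · simp [extendTableau]

/-- The branching rule for Schur polynomials. -/
theorem schurValue_succ {n : ℕ} {lam : Fin (n + 1) → ℕ} (hlam : Antitone lam)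
    (x : Fin (n + 1) → R) :
    schurValue lam x = ∑ μ ∈ interlacing lam, schurValue μ (fun i => x i.castSucc) *
      (x (Fin.last n) ^ lam (Fin.last n) *
        ∏ i : Fin n, x (Fin.last n) ^ (lam i.castSucc - μ i)) := by
  classical
  simp only [schurValue, sum_mul]
  rw [sum_sigma']
  symm
  refine sum_bij (fun p hp => ⟨extendTableau lam p.1 p.2.1,
    isSSYT_extendTableau (mem_sigma.1 hp).1 p.2.2⟩) (fun _ _ => mem_univ _) ?_ ?_ ?_
  · rintro ⟨μ, T, hT⟩ hp ⟨μ', T', hT'⟩ hp' h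
    obtain ⟨rfl, h⟩ := extendTableau_injective (mem_sigma.1 hp).1 (mem_sigma.1 hp').1
      (Subtype.ext_iff.1 h)
    cases h
    rfl
  · rintro ⟨T, hT⟩ -
    obtain ⟨μ, hμ, T', hT', h⟩ := exists_extendTableau_eq hlam hT
    exact ⟨⟨μ, T', hT'⟩, mem_sigma.2 ⟨hμ, mem_univ _⟩, Subtype.ext h⟩
  · rintro ⟨μ, T, hT⟩ hp
    exact (prod_extendTableau (mem_sigma.1 hp).1 T x).symm

/-- The dual Pieri rule, with all elementary symmetric polynomials collected in a product. -/
theorem schurValue_mul_prod_one_add (x : R) : ∀ {m : ℕ} {ν : Fin m → ℕ}, Antitone ν →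
    ∀ y : Fin m → R, schurValue ν y * ∏ j, (1 + x * y j) =
      ∑ lam ∈ verticalStrips ν, (∏ i, x ^ (lam i - ν i)) * schurValue lam y
  | 0, ν, _, y => by
    have h : verticalStrips ν = {ν} := by
      ext lam
      simp [mem_verticalStrips, Subsingleton.elim lam ν, Subsingleton.antitone]
    simp [h]
  | m + 1, ν, hν, y => by
    classical
    set z := y (Fin.last m)
    set y' : Fin m → R := fun i => y i.castSucc
    let P : Finset (Fin m → ℕ) := boxPartitions m (ν 0 + 1)
    have hP {ρ : Fin m → ℕ} : ρ ∈ P ↔ Antitone ρ ∧ ∀ i, ρ i ≤ ν 0 + 1 := mem_boxPartitions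
    have h1 : schurValue ν y * ∏ j, (1 + x * y j) = (1 + x * z) *
        ∑ κ ∈ interlacing ν, ∑ ρ ∈ verticalStrips κ, (∏ i, x ^ (ρ i - κ i)) *
          (z ^ ν (Fin.last m) * ∏ i : Fin m, z ^ (ν i.castSucc - κ i)) * schurValue ρ y' := by
      rw [schurValue_succ hν, Fin.prod_univ_castSucc, sum_mul, mul_sum]
      refine sum_congr rfl fun κ hκ => ?_
      have ih := schurValue_mul_prod_one_add x (antitone_of_mem_interlacing hκ) y'
      calc _ = (1 + x * z) * ((z ^ ν (Fin.last m) * ∏ i : Fin m, z ^ (ν i.castSucc - κ i)) *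
            (schurValue κ y' * ∏ j, (1 + x * y' j))) := by ring
        _ = _ := by
          rw [ih, mul_sum]
          refine congrArg _ (sum_congr rfl fun ρ _ => ?_)
          ring
    have h2 : ∑ lam ∈ verticalStrips ν, (∏ i, x ^ (lam i - ν i)) * schurValue lam y =
        ∑ lam ∈ verticalStrips ν, ∑ ρ ∈ interlacing lam, (∏ i, x ^ (lam i - ν i)) *
          (z ^ lam (Fin.last m) * ∏ i : Fin m, z ^ (lam i.castSucc - ρ i)) *
            schurValue ρ y' := by
      refine sum_congr rfl fun lam hlam => ?_
      rw [schurValue_succ (mem_verticalStrips.1 hlam).2, mul_sum]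
      refine sum_congr rfl fun ρ _ => ?_
      ring
    have c1 : ∀ κ ρ, κ ∈ interlacing ν ∧ ρ ∈ verticalStrips κ ↔
        κ ∈ {κ ∈ interlacing ν | ρ ∈ verticalStrips κ} ∧ ρ ∈ P := by
      intro κ ρ
      rw [mem_filter, iff_self_and]
      intro h
      refine hP.2 ⟨(mem_verticalStrips.1 h.2).2, fun i => ?_⟩
      exact ((mem_verticalStrips.1 h.2).1 i).2.trans (Nat.succ_le_succ
        ((mem_interlacing.1 h.1 i).2.trans (hν (Fin.zero_le _))))
    have c2 : ∀ lam ρ, lam ∈ verticalStrips ν ∧ ρ ∈ interlacing lam ↔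
        lam ∈ {lam ∈ verticalStrips ν | ρ ∈ interlacing lam} ∧ ρ ∈ P := by
      intro lam ρ
      rw [mem_filter, iff_self_and]
      intro h
      refine hP.2 ⟨antitone_of_mem_interlacing h.2, fun i => ?_⟩
      exact (mem_interlacing.1 h.2 i).2.trans (((mem_verticalStrips.1 h.1).1 _).2.trans
        (Nat.succ_le_succ (hν (Fin.zero_le _))))
    rw [h1, h2, sum_comm' c1, sum_comm' c2, mul_sum]
    refine sum_congr rfl fun ρ hρ => ?_
    rw [← sum_mul, ← sum_mul, sum_verticalStrips_eq_sum_interlacing x z hν (hP.1 hρ).1, mul_assoc]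

end Schur

section Conjugate

theorem lt_conjPartition_iff {n m : ℕ} {lam : Fin n → ℕ} (hlam : Antitone lam) (i : Fin n)
    (j : Fin m) : (i : ℕ) < conjPartition m lam j ↔ (j : ℕ) < lam i := by
  unfold conjPartition
  constructor
  · intro h
    by_contra! hj
    refine absurd h (not_lt.2 ?_)
    rw [← Fin.card_Iio i]
    refine card_le_card fun k hk => ?_
    rw [mem_filter] at hk
    rw [mem_Iio]
    by_contra! hik
    have := hlam hik
    omega
  · intro h
    rw [Nat.lt_iff_add_one_le, ← Fin.card_Iic i]
    refine card_le_card fun k hk => ?_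
    rw [mem_Iic] at hk
    rw [mem_filter]
    exact ⟨mem_univ _, h.trans_le (hlam hk)⟩

theorem conjPartition_le {n : ℕ} (m : ℕ) (lam : Fin n → ℕ) (j : Fin m) :
    conjPartition m lam j ≤ n :=
  (card_filter_le _ _).trans (by simp)

theorem antitone_conjPartition {n : ℕ} (m : ℕ) (lam : Fin n → ℕ) :
    Antitone (conjPartition m lam) := fun j j' h => by
  refine card_le_card fun k hk => ?_
  rw [mem_filter] at hk ⊢
  exact ⟨hk.1, lt_of_le_of_lt h hk.2⟩

theorem conjPartition_conjPartition {n m : ℕ} {lam : Fin n → ℕ} (hlam : Antitone lam)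
    (hm : ∀ i, lam i ≤ m) : conjPartition n (conjPartition m lam) = lam := by
  funext i
  have (j : Fin m) : (i : ℕ) < conjPartition m lam j ↔ (j : ℕ) < lam i :=
    lt_conjPartition_iff hlam i j
  change #{j : Fin m | (i : ℕ) < conjPartition m lam j} = lam i
  simp only [this]
  rw [Fin.card_filter_val_lt, min_eq_right (hm i)]

theorem sum_conjPartition {n m : ℕ} {lam : Fin n → ℕ} (hm : ∀ i, lam i ≤ m) :
    ∑ j, conjPartition m lam j = ∑ i, lam i := by
  unfold conjPartition
  simp only [card_filter]
  rw [sum_comm]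
  refine sum_congr rfl fun i _ => ?_
  rw [← card_filter, Fin.card_filter_val_lt, min_eq_right (hm i)]

theorem mem_verticalStrips_conjPartition_iff {n m : ℕ} {lam : Fin (n + 1) → ℕ} {μ : Fin n → ℕ}
    (hlam : Antitone lam) (hμ : Antitone μ) (hlm : ∀ i, lam i ≤ m) (hμm : ∀ i, μ i ≤ m) :
    conjPartition m lam ∈ verticalStrips (conjPartition m μ) ↔ μ ∈ interlacing lam := by
  rw [mem_verticalStrips, mem_interlacing]
  constructor
  · rintro ⟨h, -⟩ i
    constructor
    · by_contra! hlt
      let j : Fin m := ⟨μ i, hlt.trans_le (hlm _)⟩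
      have h1 := (lt_conjPartition_iff hlam i.succ j).2 hlt
      have h2 := (lt_conjPartition_iff hμ i j).not.2 (lt_irrefl _)
      have h3 := (h j).2
      rw [Fin.val_succ] at h1
      omega
    · by_contra! hlt
      let j : Fin m := ⟨lam i.castSucc, hlt.trans_le (hμm _)⟩
      have h1 := (lt_conjPartition_iff hμ i j).2 hlt
      have h2 := (lt_conjPartition_iff hlam i.castSucc j).not.2 (lt_irrefl _)
      have h3 := (h j).1
      rw [Fin.val_castSucc] at h2
      omega
  · intro h
    refine ⟨fun j => ⟨?_, ?_⟩, antitone_conjPartition _ _⟩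
    · by_contra! hlt
      let i : Fin n := ⟨conjPartition m lam j, hlt.trans_le (conjPartition_le _ _ _)⟩
      have h1 := (lt_conjPartition_iff hμ i j).1 hlt
      have h2 := (lt_conjPartition_iff hlam i.castSucc j).not.1 (lt_irrefl _)
      have h3 := (h i).2
      omega
    · by_contra! hlt
      let i : Fin n := ⟨conjPartition m μ j, by have := conjPartition_le m lam j; omega⟩
      have h1 := (lt_conjPartition_iff hlam i.succ j).1 (by simpa [i] using hlt)
      have h2 := (lt_conjPartition_iff hμ i j).not.1 (lt_irrefl _)
      have h3 := (h i).1
      omega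

end Conjugate

section DualCauchy

variable {R : Type*} [CommRing R]

theorem prod_pow_conjPartition_sub (x : R) {n m : ℕ} {lam : Fin (n + 1) → ℕ} {μ : Fin n → ℕ}
    (h : μ ∈ interlacing lam) (hlm : ∀ i, lam i ≤ m) (hμm : ∀ i, μ i ≤ m) :
    ∏ j, x ^ (conjPartition m lam j - conjPartition m μ j) =
      x ^ lam (Fin.last n) * ∏ i : Fin n, x ^ (lam i.castSucc - μ i) := by
  have hv := mem_verticalStrips.1 ((mem_verticalStrips_conjPartition_iff
    (antitone_of_interlacing_mem h) (antitone_of_mem_interlacing h) hlm hμm).2 h)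
  have hle := fun i => (mem_interlacing.1 h i).2
  rw [prod_pow_eq_pow_sum, prod_pow_eq_pow_sum, ← pow_add,
    sum_tsub_distrib _ fun j _ => (hv.1 j).1, sum_tsub_distrib _ fun i _ => hle i,
    sum_conjPartition hlm, sum_conjPartition hμm, Fin.sum_univ_castSucc]
  have := sum_le_sum fun i (_ : i ∈ univ) => hle i
  congr 1
  omega

theorem prod_one_add_mul_eq_sum_schurValue {m : ℕ} (y : Fin m → R) : ∀ {n : ℕ} (x : Fin n → R),
    ∏ i, ∏ j, (1 + x i * y j) =
      ∑ lam ∈ boxPartitions n m, schurValue lam x * schurValue (conjPartition m lam) y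
  | 0, x => by
    have h : boxPartitions 0 m = {fun i => i.elim0} := by
      ext lam
      simp [mem_boxPartitions, Subsingleton.elim lam fun i => i.elim0, Subsingleton.antitone]
    rw [h, sum_singleton, schurValue_eq_one fun i => i.elim0,
      schurValue_eq_one fun j => by simp [conjPartition]]
    simp
  | n + 1, x => by
    classical
    have h2 : ∀ μ ∈ boxPartitions n m,
        schurValue (conjPartition m μ) y * ∏ j, (1 + x (Fin.last n) * y j) =
        ∑ lam ∈ boxPartitions (n + 1) m with μ ∈ interlacing lam,
          (x (Fin.last n) ^ lam (Fin.last n) *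
            ∏ i : Fin n, x (Fin.last n) ^ (lam i.castSucc - μ i)) *
          schurValue (conjPartition m lam) y := by
      intro μ hμ
      obtain ⟨hμa, hμm⟩ := mem_boxPartitions.1 hμ
      rw [schurValue_mul_prod_one_add _ (antitone_conjPartition m μ)]
      symm
      refine sum_bij' (fun lam _ => conjPartition m lam) (fun ν _ => conjPartition (n + 1) ν)
        ?_ ?_ ?_ ?_ ?_
      · intro lam hlam
        rw [mem_filter, mem_boxPartitions] at hlam
        exact (mem_verticalStrips_conjPartition_iff hlam.1.1 hμa hlam.1.2 hμm).2 hlam.2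
      · intro ν hν
        have hν' := mem_verticalStrips.1 hν
        have hn (j) : ν j ≤ n + 1 :=
          (hν'.1 j).2.trans (Nat.succ_le_succ (conjPartition_le _ _ _))
        rw [mem_filter, mem_boxPartitions]
        refine ⟨⟨antitone_conjPartition _ _, conjPartition_le _ _⟩, ?_⟩
        rwa [← mem_verticalStrips_conjPartition_iff (antitone_conjPartition _ _) hμa
          (conjPartition_le _ _) hμm, conjPartition_conjPartition hν'.2 hn]
      · intro lam hlam
        rw [mem_filter, mem_boxPartitions] at hlam
        exact conjPartition_conjPartition hlam.1.1 hlam.1.2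
      · intro ν hν
        have hν' := mem_verticalStrips.1 hν
        exact conjPartition_conjPartition hν'.2 fun j =>
          (hν'.1 j).2.trans (Nat.succ_le_succ (conjPartition_le _ _ _))
      · intro lam hlam
        rw [mem_filter, mem_boxPartitions] at hlam
        rw [prod_pow_conjPartition_sub _ hlam.2 hlam.1.2 hμm]
    have hc : ∀ lam μ, lam ∈ boxPartitions (n + 1) m ∧ μ ∈ interlacing lam ↔
        lam ∈ {lam ∈ boxPartitions (n + 1) m | μ ∈ interlacing lam} ∧ μ ∈ boxPartitions n m := by
      intro lam μ
      rw [mem_filter, iff_self_and]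
      intro h
      exact mem_boxPartitions.2 ⟨antitone_of_mem_interlacing h.2, fun i =>
        (mem_interlacing.1 h.2 i).2.trans ((mem_boxPartitions.1 h.1).2 _)⟩
    rw [Fin.prod_univ_castSucc, prod_one_add_mul_eq_sum_schurValue y fun i => x i.castSucc,
      sum_mul]
    calc _ = ∑ μ ∈ boxPartitions n m, ∑ lam ∈ boxPartitions (n + 1) m with μ ∈ interlacing lam,
          schurValue μ (fun i => x i.castSucc) * ((x (Fin.last n) ^ lam (Fin.last n) *
            ∏ i : Fin n, x (Fin.last n) ^ (lam i.castSucc - μ i)) *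
          schurValue (conjPartition m lam) y) := by
          refine sum_congr rfl fun μ hμ => ?_
          rw [mul_assoc, h2 μ hμ, mul_sum]
      _ = _ := by
          rw [← sum_comm' hc]
          refine sum_congr rfl fun lam hlam => ?_
          rw [schurValue_succ (mem_boxPartitions.1 hlam).1, sum_mul]
          refine sum_congr rfl fun μ _ => ?_
          ring

end DualCauchy

end DualCauchyIdentity

open MvPolynomial in
/-- dual Cauchy identity: for `n, m ≥ 1`, in
`ℤ[x_1,…,x_n,y_1,…,y_m]` (variables `Fin n ⊕ Fin m`),
`∏_{i=1}^n ∏_{j=1}^m (1 + x_i y_j) = Σ_λ S_λ(x) S_{λ'}(y)`, where `λ` ranges over all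
partitions fitting in an `n × m` box and `λ'` is the conjugate partition. -/
theorem dual_cauchy_identity (n m : ℕ) (hn : 1 ≤ n) (hm : 1 ≤ m) :
    (∏ i : Fin n, ∏ j : Fin m,
      (1 + X (Sum.inl i) * X (Sum.inr j) : MvPolynomial (Fin n ⊕ Fin m) ℤ))
    = ∑ᶠ lam : {lam : Fin n → ℕ // Antitone lam ∧ ∀ i, lam i ≤ m},
        MvPolynomial.rename Sum.inl (schurPoly n lam.1) *
        MvPolynomial.rename Sum.inr (schurPoly m (conjPartition m lam.1)) := by
  simp only [rename_schurPoly]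
  rw [prod_one_add_mul_eq_sum_schurValue, ← finsum_mem_coe_finset]
  simp only [Finset.mem_coe, mem_boxPartitions]
  exact (finsum_subtype_eq_finsum_cond _).symm
end

section
/- Let n ≥ 1 and let λ = (λ_1 ≥ λ_2 ≥ … ≥ λ_n ≥ 0) be a partition with at most n parts, and let a_1, a_2, a_3, … be a sequence of parameters. Then, in the polynomial ring over ℤ in x_1,…,x_n and the parameters a_k, the factorial Schur polynomial satisfies S_λ(x | a) · det(x_i^{n−j})_{1≤i,j≤n} = det((x_i | a)^{λ_j+n−j})_{1≤i,j≤n}, where (z | a)^k denotes the falling product (z − a_1)(z − a_2)⋯(z − a_k). -/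
open MvPolynomial in
/-- The factorial Schur polynomial `S_λ(x | a) = Σ_T ∏_{(i,j) ∈ λ} (x_{T(i,j)} - a_{T(i,j)+j-i})`
(rows `i`, columns `j`, and entries `T(i,j)` 1-based in the displayed formula; our cells and
entries are 0-indexed, so cell `(i,j)` with entry `t` contributes `x_{t+1} - a_{(t+1)+j-i}`).
We work in `ℤ[x_1,…,x_n; a_1, a_2, …]`: the variable `Sum.inl i` is `x_{i+1}` and the variable
`Sum.inr k` is the parameter `a_k`. -/
noncomputable def factorialSchurPoly (n : ℕ) (lam : Fin n → ℕ) :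
    MvPolynomial (Fin n ⊕ ℕ) ℤ :=
  ∑ᶠ T : {T : ∀ i : Fin n, Fin (lam i) → Fin n // IsSSYT lam T},
    ∏ i : Fin n, ∏ j : Fin (lam i),
      (X (Sum.inl (T.1 i j)) - X (Sum.inr (((T.1 i j : ℕ) + 1) + (j : ℕ) - (i : ℕ))))

/-- A determinant whose last row satisfies `A last j = c j * A last (j + 1)` reduces to a minor
after subtracting `c j` times column `j + 1` from column `j`. -/
theorem Matrix.det_eq_mul_det_of_last_row {R : Type*} [CommRing R] {n : ℕ}
    (A : Matrix (Fin (n + 1)) (Fin (n + 1)) R) (c : Fin n → R)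
    (h : ∀ j : Fin n, A (Fin.last n) j.castSucc = c j * A (Fin.last n) j.succ) :
    A.det = A (Fin.last n) (Fin.last n) *
      (Matrix.of fun i j : Fin n =>
        A i.castSucc j.castSucc - c j * A i.castSucc j.succ).det := by
  let B : Matrix (Fin (n + 1)) (Fin (n + 1)) R := Matrix.of fun i j =>
    Fin.cases (A i.rev (Fin.last n))
      (fun k : Fin n => A i.rev k.rev.castSucc - c k.rev * A i.rev k.rev.succ) j
  have hAB : (A.submatrix Fin.revPerm Fin.revPerm).det = B.det := by
    refine Matrix.det_eq_of_forall_col_eq_smul_add_pred (fun k => c k.rev) ?_ ?_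
    · intro i
      simp [B]
    · intro i j
      simp [B, Fin.rev_succ, Fin.rev_castSucc]
  rw [← Matrix.det_submatrix_equiv_self Fin.revPerm A, hAB, Matrix.det_succ_row_zero,
    Fin.sum_univ_succ, Finset.sum_eq_zero, add_zero]
  · rw [← Matrix.det_submatrix_equiv_self Fin.revPerm (Matrix.of fun i j : Fin n =>
        A i.castSucc j.castSucc - c j * A i.castSucc j.succ)]
    have hs : B.submatrix Fin.succ (Fin.succAbove 0) =
        (Matrix.of fun i j : Fin n =>
          A i.castSucc j.castSucc - c j * A i.castSucc j.succ).submatrix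
            Fin.revPerm Fin.revPerm := by
      ext i j
      simp [B, Fin.rev_succ]
    rw [hs]
    simp [B]
  · intro j _
    simp [B, h]

/-- The determinant of a matrix whose columns are sums, expanded by multilinearity. -/
theorem Matrix.det_of_sum_columns {R ι : Type*} [CommRing R] {n : ℕ}
    (s : Fin n → Finset ι) (f : Fin n → Fin n → ι → R) (w : Fin n → ι → R) :
    (Matrix.of fun i j : Fin n => ∑ k ∈ s j, w j k * f i j k).det =
      ∑ m ∈ Fintype.piFinset s,
        (∏ j, w j (m j)) * (Matrix.of fun i j : Fin n => f i j (m j)).det := by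
  classical
  have key := (Matrix.detRowAlternating (n := Fin n) (R := R)).toMultilinearMap.map_sum_finset
    (fun j k i => w j k * f i j k) s
  refine (Matrix.det_transpose _).symm.trans (Eq.trans ?_ (key.trans ?_))
  · change Matrix.det _ = Matrix.det _
    congr 1
    ext j i
    simp [Finset.sum_apply]
  · refine Finset.sum_congr rfl fun m _ => ?_
    rw [← Matrix.det_mul_row, ← Matrix.det_transpose]
    rfl

/-- The generalized power `(z | a)^k = (z - a_1) ⋯ (z - a_k)`. -/
def generalizedPower {R : Type*} [CommRing R] (a : ℕ → R) (z : R) (k : ℕ) : R :=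
  ∏ r ∈ Finset.Icc 1 k, (z - a r)

section Bialternant

variable {R : Type*} [CommRing R] (a : ℕ → R)

theorem generalizedPower_zero (z : R) : generalizedPower a z 0 = 1 := by
  simp [generalizedPower]

theorem generalizedPower_succ (z : R) (k : ℕ) :
    generalizedPower a z (k + 1) = generalizedPower a z k * (z - a (k + 1)) := by
  simp [generalizedPower, Finset.prod_Icc_succ_top]

theorem generalizedPower_mul_prod_Ico (z : R) {u v : ℕ} (e : ℕ) (huv : u ≤ v) :
    generalizedPower a z (u + e) * ∏ j ∈ Finset.Ico u v, (z - a (j + e + 1)) =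
      generalizedPower a z (v + e) := by
  induction v, huv using Nat.le_induction with
  | base => simp
  | succ v huv ih =>
    rw [Finset.prod_Ico_succ_top huv, ← mul_assoc, ih, add_right_comm v 1 e,
      generalizedPower_succ]

/-- The divided difference of generalized powers. -/
theorem generalizedPower_sub_eq_sum (x y : R) {u v : ℕ} (e : ℕ) (huv : u ≤ v) :
    generalizedPower a x (v + e + 1) -
        (∏ j ∈ Finset.Ico u (v + 1), (y - a (j + e + 1))) * generalizedPower a x (u + e) =
      (x - y) * ∑ k ∈ Finset.Icc u v,
        (∏ j ∈ Finset.Ico k v, (y - a (j + e + 2))) * generalizedPower a x (k + e) := by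
  induction v, huv using Nat.le_induction with
  | base =>
    simp [generalizedPower_succ]
    ring
  | succ v huv ih =>
    have hsum : ∑ k ∈ Finset.Icc u v,
          (∏ j ∈ Finset.Ico k (v + 1), (y - a (j + e + 2))) * generalizedPower a x (k + e) =
        (y - a (v + e + 2)) * ∑ k ∈ Finset.Icc u v,
          (∏ j ∈ Finset.Ico k v, (y - a (j + e + 2))) * generalizedPower a x (k + e) := by
      rw [Finset.mul_sum]
      refine Finset.sum_congr rfl fun k hk => ?_
      rw [Finset.prod_Ico_succ_top (Finset.mem_Icc.mp hk).2]
      ring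
    rw [Finset.sum_Icc_succ_top (by omega), hsum, mul_add, mul_left_comm, ← ih,
      Finset.prod_Ico_succ_top (by omega : u ≤ v + 1), generalizedPower_succ,
      show v + 1 + e = v + e + 1 by ring]
    simp
    ring

/-- The bialternant numerator `det ((x_i | a)^{λ_j + n - j})`. -/
noncomputable def alternant (n : ℕ) (x : Fin n → R) (lam : Fin n → ℕ) : R :=
  (Matrix.of fun i j : Fin n => generalizedPower a (x i) (lam j + (n - 1 - (j : ℕ)))).det

theorem alternant_succ (n : ℕ) (x : Fin (n + 1) → R) (lam : Fin (n + 1) → ℕ)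
    (hlam : Antitone lam) :
    alternant a (n + 1) x lam =
      generalizedPower a (x (Fin.last n)) (lam (Fin.last n)) *
      ((∏ i : Fin n, (x i.castSucc - x (Fin.last n))) *
        ∑ m ∈ Fintype.piFinset fun i : Fin n => Finset.Icc (lam i.succ) (lam i.castSucc),
          (∏ i : Fin n, ∏ j ∈ Finset.Ico (m i) (lam i.castSucc),
            (x (Fin.last n) - a (n + 1 + j - i))) *
          alternant a n (fun i => x i.castSucc) m) := by
  unfold alternant
  have hle (j : Fin n) : lam j.succ ≤ lam j.castSucc := hlam (Fin.castSucc_lt_succ).le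
  have he (j : Fin n) : n + 1 - 1 - (j.castSucc : ℕ) = (n - 1 - j) + 1 := by
    simp
    omega
  have he' (j : Fin n) : n + 1 - 1 - (j.succ : ℕ) = n - 1 - j := by
    simp
    omega
  rw [Matrix.det_eq_mul_det_of_last_row _ fun j : Fin n =>
    ∏ k ∈ Finset.Ico (lam j.succ) (lam j.castSucc + 1),
      (x (Fin.last n) - a (k + (n - 1 - j) + 1))]
  · simp only [Matrix.of_apply, he, he', ← add_assoc]
    simp only [generalizedPower_sub_eq_sum a _ _ _ (hle _)]
    rw [← Matrix.det_of_sum_columns _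
      (fun i j k => generalizedPower a (x i.castSucc) (k + (n - 1 - j)))
      (fun i k => ∏ j ∈ Finset.Ico k (lam i.castSucc), (x (Fin.last n) - a (n + 1 + j - i))),
      ← Matrix.det_mul_column]
    congr 2
    · simp
    · ext i j
      simp only [Matrix.of_apply]
      congr 1
      refine Finset.sum_congr rfl fun k _ => ?_
      congr 1
      refine Finset.prod_congr rfl fun r _ => ?_
      congr 2
      omega
  · intro j
    simp only [Matrix.of_apply, he, he']
    rw [mul_comm, generalizedPower_mul_prod_Ico a _ _ ((hle j).trans (Nat.le_succ _))]
    congr 1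
    omega

theorem det_pow_succ (n : ℕ) (x : Fin (n + 1) → R) :
    (Matrix.of fun i j : Fin (n + 1) => x i ^ (n + 1 - 1 - (j : ℕ))).det =
      (∏ i : Fin n, (x i.castSucc - x (Fin.last n))) *
        (Matrix.of fun i j : Fin n => x i.castSucc ^ (n - 1 - (j : ℕ))).det := by
  have he (j : Fin n) : n + 1 - 1 - (j.castSucc : ℕ) = (n - 1 - j) + 1 := by
    simp
    omega
  have he' (j : Fin n) : n + 1 - 1 - (j.succ : ℕ) = n - 1 - j := by
    simp
    omega
  rw [Matrix.det_eq_mul_det_of_last_row _ fun _ => x (Fin.last n), ← Matrix.det_mul_column]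
  · simp only [Matrix.of_apply, he, he']
    simp only [Fin.val_last, Nat.add_sub_cancel, Nat.sub_self, pow_zero, one_mul]
    congr 1
    ext i j
    simp only [Matrix.of_apply]
    ring
  · intro j
    simp only [Matrix.of_apply, he, he']
    ring

end Bialternant

section Tableaux

variable {n : ℕ}

theorem IsSSYT.row_le_entry {lam : Fin n → ℕ} {T : ∀ i : Fin n, Fin (lam i) → Fin n}
    (hT : IsSSYT lam T) (hlam : Antitone lam) (i : Fin n) (j : Fin (lam i)) :
    (i : ℕ) ≤ T i j := by
  obtain ⟨i, hi⟩ := i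
  induction i with
  | zero => simp
  | succ i ih =>
    have hle : lam ⟨i + 1, hi⟩ ≤ lam ⟨i, by omega⟩ := hlam (by simp)
    have h1 := ih (by omega) ⟨j, j.2.trans_le hle⟩
    have h2 := hT.2 ⟨i, by omega⟩ ⟨i + 1, hi⟩ ⟨j, j.2.trans_le hle⟩ j (by simp) rfl
    have h3 : (T ⟨i, by omega⟩ ⟨j, j.2.trans_le hle⟩ : ℕ) < T ⟨i + 1, hi⟩ j := h2
    simp only at h1 ⊢
    omega

/-- Extend a filling of shape `m` with entries below `n` to shape `lam` by placing the largest
entry in all the remaining cells. -/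
def extendFilling (lam : Fin (n + 1) → ℕ) (m : Fin n → ℕ) (T : ∀ i : Fin n, Fin (m i) → Fin n) :
    ∀ i : Fin (n + 1), Fin (lam i) → Fin (n + 1) := fun i j =>
  if h : ∃ h : (i : ℕ) < n, (j : ℕ) < m ⟨i, h⟩ then (T ⟨i, h.1⟩ ⟨j, h.2⟩).castSucc
  else Fin.last n

variable {lam : Fin (n + 1) → ℕ} {m : Fin n → ℕ}

theorem extendFilling_last (T : ∀ i : Fin n, Fin (m i) → Fin n) (j : Fin (lam (Fin.last n))) :
    extendFilling lam m T (Fin.last n) j = Fin.last n := by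
  simp [extendFilling]

theorem extendFilling_of_lt (T : ∀ i : Fin n, Fin (m i) → Fin n) (i : Fin n)
    (j : Fin (lam i.castSucc)) (h : (j : ℕ) < m i) :
    extendFilling lam m T i.castSucc j = (T i ⟨j, h⟩).castSucc := by
  simp [extendFilling, h]

theorem extendFilling_of_le (T : ∀ i : Fin n, Fin (m i) → Fin n) (i : Fin n)
    (j : Fin (lam i.castSucc)) (h : m i ≤ j) :
    extendFilling lam m T i.castSucc j = Fin.last n := by
  simp [extendFilling, h]

theorem extendFilling_ne_last_iff (T : ∀ i : Fin n, Fin (m i) → Fin n) (i : Fin n)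
    (j : Fin (lam i.castSucc)) :
    extendFilling lam m T i.castSucc j ≠ Fin.last n ↔ (j : ℕ) < m i := by
  rcases lt_or_ge (j : ℕ) (m i) with h | h
  · simp [extendFilling_of_lt T i j h, h, (Fin.castSucc_lt_last _).ne]
  · simp [extendFilling_of_le T i j h, h]

theorem antitone_of_interlacing (hlam : Antitone lam)
    (hm : ∀ i : Fin n, lam i.succ ≤ m i ∧ m i ≤ lam i.castSucc) : Antitone m := by
  intro i i' h
  rcases h.eq_or_lt with rfl | h
  · exact le_rfl
  · exact (hm i').2.trans ((hlam (Fin.succ_le_castSucc_iff.mpr h)).trans (hm i).1)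

theorem isSSYT_extendFilling (hlam : Antitone lam)
    (hm : ∀ i : Fin n, lam i.succ ≤ m i ∧ m i ≤ lam i.castSucc)
    {T : ∀ i : Fin n, Fin (m i) → Fin n} (hT : IsSSYT m T) :
    IsSSYT lam (extendFilling lam m T) := by
  refine ⟨fun i j j' hj => ?_, fun i i' j j' hi hj => ?_⟩
  · induction i using Fin.lastCases with
    | last => simp [extendFilling_last]
    | cast i =>
      rcases lt_or_ge (j' : ℕ) (m i) with h | h
      · have h' : (j : ℕ) < m i := lt_of_le_of_lt hj h
        rw [extendFilling_of_lt T i j h', extendFilling_of_lt T i j' h, Fin.castSucc_le_castSucc_iff]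
        exact hT.1 i _ _ hj
      · rw [extendFilling_of_le T i j' h]
        exact Fin.le_last _
  · induction i using Fin.lastCases with
    | last => exact absurd hi (Fin.le_last i').not_gt
    | cast i =>
      have h : (j : ℕ) < m i := by
        have := hlam (Fin.castSucc_lt_iff_succ_le.mp hi)
        have := (hm i).1
        omega
      rw [extendFilling_of_lt T i j h]
      induction i' using Fin.lastCases with
      | last =>
        rw [extendFilling_last]
        exact Fin.castSucc_lt_last _
      | cast i' =>
        rcases lt_or_ge (j' : ℕ) (m i') with h' | h'
        · rw [extendFilling_of_lt T i' j' h', Fin.castSucc_lt_castSucc_iff]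
          exact hT.2 i i' _ _ (by simpa using hi) hj
        · rw [extendFilling_of_le T i' j' h']
          exact Fin.castSucc_lt_last _

theorem IsSSYT.exists_row_length {T : ∀ i : Fin (n + 1), Fin (lam i) → Fin (n + 1)}
    (hT : IsSSYT lam T) (hlam : Antitone lam) (i : Fin n) :
    ∃ k, (lam i.succ ≤ k ∧ k ≤ lam i.castSucc) ∧
      ∀ j : Fin (lam i.castSucc), (j : ℕ) < k ↔ T i.castSucc j ≠ Fin.last n := by
  classical
  have hex : ∃ k, ∀ h : k < lam i.castSucc, T i.castSucc ⟨k, h⟩ = Fin.last n :=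
    ⟨lam i.castSucc, fun h => absurd h (lt_irrefl _)⟩
  have hspec := Nat.find_spec hex
  have hle : Nat.find hex ≤ lam i.castSucc := Nat.find_min' hex fun h => absurd h (lt_irrefl _)
  refine ⟨Nat.find hex, ⟨?_, hle⟩, fun j => ⟨fun hj h => ?_, fun hj => ?_⟩⟩
  · by_contra! hlt
    have hlt' := hlt.trans_le (hlam (Fin.castSucc_lt_succ (i := i)).le)
    have := hT.2 i.castSucc i.succ ⟨_, hlt'⟩ ⟨_, hlt⟩ Fin.castSucc_lt_succ rfl
    rw [hspec hlt'] at this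
    exact (Fin.le_last _).not_gt this
  · exact Nat.find_min hex hj fun _ => h
  · by_contra! hk
    refine hj (Fin.last_le_iff.mp ?_)
    rw [← hspec (hk.trans_lt j.2)]
    exact hT.1 i.castSucc _ _ hk

theorem IsSSYT.exists_eq_extendFilling {T : ∀ i : Fin (n + 1), Fin (lam i) → Fin (n + 1)}
    (hT : IsSSYT lam T) (hlam : Antitone lam) :
    ∃ (m : Fin n → ℕ) (_ : ∀ i : Fin n, lam i.succ ≤ m i ∧ m i ≤ lam i.castSucc)
      (T' : ∀ i : Fin n, Fin (m i) → Fin n), IsSSYT m T' ∧ extendFilling lam m T' = T := by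
  choose m hm hmT using hT.exists_row_length hlam
  refine ⟨m, hm, fun i j => (T i.castSucc ⟨j, j.2.trans_le (hm i).2⟩).castPred
    ((hmT i _).mp j.2), ⟨fun i j j' hj => ?_, fun i i' j j' hi hj => ?_⟩, ?_⟩
  · exact Fin.castPred_le_castPred_iff.mpr (hT.1 _ _ _ hj)
  · exact Fin.castPred_lt_castPred_iff.mpr (hT.2 _ _ _ _ (by simpa using hi) hj)
  · funext i j
    induction i using Fin.lastCases with
    | last =>
      rw [extendFilling_last]
      exact (Fin.last_le_iff.mp (hT.row_le_entry hlam (Fin.last n) j)).symm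
    | cast i =>
      rcases lt_or_ge (j : ℕ) (m i) with h | h
      · rw [extendFilling_of_lt _ i j h]
        simp
      · rw [extendFilling_of_le _ i j h]
        by_contra hne
        exact h.not_gt ((hmT i j).mpr (Ne.symm hne))

theorem eq_of_extendFilling_eq {m' : Fin n → ℕ} (hm : ∀ i, m i ≤ lam i.castSucc)
    (hm' : ∀ i, m' i ≤ lam i.castSucc) {T : ∀ i : Fin n, Fin (m i) → Fin n}
    {T' : ∀ i : Fin n, Fin (m' i) → Fin n}
    (h : extendFilling lam m T = extendFilling lam m' T') :
    m = m' ∧ HEq T T' := by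
  have key (i : Fin n) (j : ℕ) (hj : j < lam i.castSucc) : j < m i ↔ j < m' i := by
    rw [← extendFilling_ne_last_iff T i ⟨j, hj⟩, ← extendFilling_ne_last_iff T' i ⟨j, hj⟩, h]
  have hmm : m = m' := by
    funext i
    refine le_antisymm ?_ ?_
    · by_contra! hlt
      exact lt_irrefl _ ((key i (m' i) (hlt.trans_le (hm i))).mp hlt)
    · by_contra! hlt
      exact lt_irrefl _ ((key i (m i) (hlt.trans_le (hm' i))).mpr hlt)
  subst hmm
  refine ⟨rfl, heq_of_eq ?_⟩
  funext i j
  have := congrFun (congrFun h i.castSucc) ⟨j, j.2.trans_le (hm i)⟩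
  rw [extendFilling_of_lt T i _ j.2, extendFilling_of_lt T' i _ j.2] at this
  exact Fin.castSucc_injective _ this

end Tableaux

theorem Fin.prod_univ_eq_prod_mul_prod_Ico {M : Type*} [CommMonoid M] {k l : ℕ} (hkl : k ≤ l)
    (f : Fin l → M) (g : Fin k → M) (h : ℕ → M)
    (hg : ∀ j : Fin k, f (Fin.castLE hkl j) = g j) (hh : ∀ j : Fin l, k ≤ j → f j = h j) :
    ∏ j, f j = (∏ j, g j) * ∏ j ∈ Finset.Ico k l, h j := by
  obtain ⟨d, rfl⟩ := Nat.exists_eq_add_of_le hkl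
  rw [Fin.prod_univ_add, Finset.prod_Ico_eq_prod_range, Nat.add_sub_cancel_left,
    ← Fin.prod_univ_eq_prod_range]
  congr 1
  · exact Finset.prod_congr rfl fun j _ => hg j
  · exact Finset.prod_congr rfl fun j _ => hh _ (by simp)

theorem finsum_subtype_eq_sum_filter {α M : Type*} [Fintype α] [AddCommMonoid M] (p : α → Prop)
    [DecidablePred p] (f : α → M) : ∑ᶠ t : {t // p t}, f t = ∑ t with p t, f t := by
  rw [finsum_eq_sum_of_fintype]
  exact (Finset.sum_subtype _ (by simp) _).symm

section FactorialSchur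

variable {R : Type*} [CommRing R] (a : ℕ → R) {n : ℕ}

/-- The weight of a filling in the factorial Schur function. -/
def fillingWeight (x : Fin n → R) (lam : Fin n → ℕ) (T : ∀ i : Fin n, Fin (lam i) → Fin n) : R :=
  ∏ i : Fin n, ∏ j : Fin (lam i), (x (T i j) - a (((T i j : ℕ) + 1) + (j : ℕ) - (i : ℕ)))

open Classical in
/-- The factorial Schur function with variables and parameters in any commutative ring. -/
noncomputable def factorialSchur (x : Fin n → R) (lam : Fin n → ℕ) : R :=
  ∑ T with IsSSYT lam T, fillingWeight a x lam T

theorem fillingWeight_extendFilling (x : Fin (n + 1) → R) {lam : Fin (n + 1) → ℕ}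
    {m : Fin n → ℕ} (hm : ∀ i, m i ≤ lam i.castSucc) (T : ∀ i : Fin n, Fin (m i) → Fin n) :
    fillingWeight a x lam (extendFilling lam m T) =
      generalizedPower a (x (Fin.last n)) (lam (Fin.last n)) *
      ((∏ i : Fin n, ∏ j ∈ Finset.Ico (m i) (lam i.castSucc),
          (x (Fin.last n) - a (n + 1 + j - i))) *
        fillingWeight a (fun i => x i.castSucc) m T) := by
  unfold fillingWeight
  rw [Fin.prod_univ_castSucc, mul_comm]
  congr 1
  · simp only [extendFilling_last, Fin.val_last]
    rw [Fin.prod_univ_eq_prod_range (fun j => x (Fin.last n) - a (n + 1 + j - n)),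
      Finset.range_eq_Ico]
    have key := generalizedPower_mul_prod_Ico a (x (Fin.last n)) 0
      (Nat.zero_le (lam (Fin.last n)))
    simp only [add_zero, generalizedPower_zero, one_mul] at key
    rw [← key]
    refine Finset.prod_congr rfl fun j _ => ?_
    congr 2
    omega
  · rw [mul_comm, ← Finset.prod_mul_distrib]
    refine Finset.prod_congr rfl fun i _ => ?_
    refine Fin.prod_univ_eq_prod_mul_prod_Ico (hm i) _ _ _ (fun j => ?_) (fun j hj => ?_)
    · rw [extendFilling_of_lt T i _ j.2]
      simp
    · rw [extendFilling_of_le T i _ hj]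
      simp

theorem factorialSchur_succ (x : Fin (n + 1) → R) {lam : Fin (n + 1) → ℕ}
    (hlam : Antitone lam) :
    factorialSchur a x lam =
      generalizedPower a (x (Fin.last n)) (lam (Fin.last n)) *
        ∑ m ∈ Fintype.piFinset fun i : Fin n => Finset.Icc (lam i.succ) (lam i.castSucc),
          (∏ i : Fin n, ∏ j ∈ Finset.Ico (m i) (lam i.castSucc),
            (x (Fin.last n) - a (n + 1 + j - i))) *
          factorialSchur a (fun i => x i.castSucc) m := by
  classical
  simp only [factorialSchur, Finset.mul_sum]
  rw [Finset.sum_sigma']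
  symm
  refine Finset.sum_bij (fun p _ => extendFilling lam p.1 p.2) ?_ ?_ ?_ ?_
  · rintro ⟨m, T⟩ h
    simp only [Finset.mem_sigma, Fintype.mem_piFinset, Finset.mem_Icc, Finset.mem_filter,
      Finset.mem_univ, true_and] at h ⊢
    exact isSSYT_extendFilling hlam h.1 h.2
  · rintro ⟨m, T⟩ h ⟨m', T'⟩ h' heq
    simp only [Finset.mem_sigma, Fintype.mem_piFinset, Finset.mem_Icc] at h h'
    obtain ⟨h1, h2⟩ := eq_of_extendFilling_eq (fun i => (h.1 i).2) (fun i => (h'.1 i).2) heq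
    exact Sigma.ext h1 h2
  · intro T hT
    obtain ⟨m, hm, T', hT', rfl⟩ :=
      (Finset.mem_filter.mp hT).2.exists_eq_extendFilling hlam
    exact ⟨⟨m, T'⟩, by simpa using ⟨hm, hT'⟩, rfl⟩
  · rintro ⟨m, T⟩ h
    simp only [Finset.mem_sigma, Fintype.mem_piFinset, Finset.mem_Icc] at h
    exact (fillingWeight_extendFilling a x (fun i => (h.1 i).2) T).symm

theorem factorialSchur_mul_det_pow (x : Fin n → R) {lam : Fin n → ℕ} (hlam : Antitone lam) :
    factorialSchur a x lam * (Matrix.of fun i j : Fin n => x i ^ (n - 1 - (j : ℕ))).det =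
      alternant a n x lam := by
  induction n with
  | zero =>
    have h : IsSSYT lam = fun _ => True := by
      funext T
      simp [IsSSYT]
    simp [factorialSchur, alternant, fillingWeight, h]
  | succ n ih =>
    rw [factorialSchur_succ a x hlam, det_pow_succ, alternant_succ a n x lam hlam, mul_assoc]
    congr 1
    rw [mul_left_comm, Finset.sum_mul]
    congr 1
    refine Finset.sum_congr rfl fun m hm => ?_
    simp only [Fintype.mem_piFinset, Finset.mem_Icc] at hm
    rw [mul_assoc, ih _ (antitone_of_interlacing hlam hm)]

end FactorialSchur

open MvPolynomial in
/-- factorial Schur, bialternant form: for `n ≥ 1` and a partition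
`λ_1 ≥ … ≥ λ_n ≥ 0`, `S_λ(x | a) · det(x_i^{n-j}) = det((x_i | a)^{λ_j + n - j})`,
where `(z | a)^k = (z - a_1)⋯(z - a_k)`. -/
theorem factorial_schur_eq_quotient_of_determinants (n : ℕ) (hn : 1 ≤ n)
    (lam : Fin n → ℕ) (hlam : Antitone lam) :
    factorialSchurPoly n lam *
      (Matrix.of fun i j : Fin n =>
        (X (Sum.inl i) : MvPolynomial (Fin n ⊕ ℕ) ℤ) ^ (n - 1 - (j : ℕ))).det
    = (Matrix.of fun i j : Fin n =>
        ∏ r ∈ Finset.Icc 1 (lam j + (n - 1 - (j : ℕ))),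
          ((X (Sum.inl i) - X (Sum.inr r)) : MvPolynomial (Fin n ⊕ ℕ) ℤ)).det := by
  have h : factorialSchurPoly n lam =
      factorialSchur (fun k => X (Sum.inr k)) (fun i => X (Sum.inl i)) lam := by
    rw [factorialSchur, ← finsum_subtype_eq_sum_filter]
    simp only [factorialSchurPoly, fillingWeight]
  rw [h, factorialSchur_mul_det_pow _ _ hlam]
  simp only [alternant, generalizedPower]
end
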